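/- Let M be a d-tape automaton on alphabet A = A₁ × ⋯ × A_d, let q be a state of M, and let Y_q = {Δ(c) ∈ ℝ^d : c ∈ A^ℕ is q-accepted by M}. Then q is universal if and only if Y_q = [0,1]^d. -/

import Mathlib

/-- `ConcatEq w s` : the infinite concatenation `w 0 ++ w 1 ++ ⋯` equals the
infinite sequence `s`. -/
def ConcatEq {α : Type*} (w : ℕ → List α) (s : ℕ → α) : Prop :=
  ∀ (n : ℕ) (j : Fin (w n).length),
    s (((Finset.range n).sum fun i => (w i).length) + (j : ℕ)) = (w n).get j

/-- The configuration `c` is `q`-accepted by the `d`-tape automaton with state type `Q`,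
tape alphabets `A k` and transition set `T`. -/
def AcceptsD {d : ℕ} {Q : Type*} {A : Fin d → Type*}
    (T : Set (Q × Q × ((k : Fin d) → List (A k)))) (q : Q)
    (c : ℕ → (k : Fin d) → A k) : Prop :=
  ∃ t : ℕ → Q × Q × ((k : Fin d) → List (A k)),
    (∀ n, t n ∈ T) ∧ (t 0).1 = q ∧ (∀ n, (t n).2.1 = (t (n + 1)).1) ∧
    ∀ k : Fin d, ConcatEq (fun n => (t n).2.2 k) (fun i => c i k)

/-- `Δ_k` of an infinite word: `Σ_{i≥1} δ(u_i)·|A_k|^{-i}`. -/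
noncomputable def deltaInf {α : Type*} [Fintype α] (δ : α ≃ Fin (Fintype.card α))
    (s : ℕ → α) : ℝ :=
  ∑' i : ℕ, ((δ (s i) : ℕ) : ℝ) / (Fintype.card α : ℝ) ^ (i + 1)

/-- `Δ(c) ∈ [0,1]^d` of a configuration `c`. -/
noncomputable def DeltaC {d : ℕ} {A : Fin d → Type*} [∀ k, Fintype (A k)]
    (δ : (k : Fin d) → A k ≃ Fin (Fintype.card (A k)))
    (c : ℕ → (k : Fin d) → A k) : EuclideanSpace ℝ (Fin d) :=
  (WithLp.equiv 2 ((k : Fin d) → ℝ)).symm fun k => deltaInf (δ k) fun i => c i k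

/-- `Y_q = { Δ(c) : c is q-accepted }`. -/
noncomputable def Yset {d : ℕ} {Q : Type*} {A : Fin d → Type*} [∀ k, Fintype (A k)]
    (δ : (k : Fin d) → A k ≃ Fin (Fintype.card (A k)))
    (T : Set (Q × Q × ((k : Fin d) → List (A k)))) (q : Q) :
    Set (EuclideanSpace ℝ (Fin d)) :=
  {x | ∃ c : ℕ → (k : Fin d) → A k, AcceptsD T q c ∧ x = DeltaC δ c}

open Real in
theorem deltaInf_eq_ofDigits {α : Type*} [Fintype α] (δ : α ≃ Fin (Fintype.card α))
    (s : ℕ → α) : deltaInf δ s = ofDigits fun i => δ (s i) := by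
  simp only [deltaInf, ofDigits, ofDigitsTerm, div_eq_mul_inv]

theorem deltaInf_mem_Icc {α : Type*} [Fintype α] (δ : α ≃ Fin (Fintype.card α))
    (s : ℕ → α) : deltaInf δ s ∈ Set.Icc (0 : ℝ) 1 := by
  rw [deltaInf_eq_ofDigits]
  exact ⟨Real.ofDigits_nonneg _, Real.ofDigits_le_one _⟩

theorem exists_deltaInf_eq {α : Type*} [Fintype α] (hα : 1 < Fintype.card α)
    (δ : α ≃ Fin (Fintype.card α)) {x : ℝ} (hx : x ∈ Set.Icc (0 : ℝ) 1) :
    ∃ s : ℕ → α, deltaInf δ s = x := by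
  obtain ⟨u, -, hu⟩ := Real.ofDigits_SurjOn hα hx
  exact ⟨fun i => δ.symm (u i), by simpa [deltaInf_eq_ofDigits] using hu⟩

theorem card_mul_deltaInf {α : Type*} [Fintype α] (δ : α ≃ Fin (Fintype.card α)) (s : ℕ → α) :
    (Fintype.card α : ℝ) * deltaInf δ s = (δ (s 0) : ℕ) + deltaInf δ fun i => s (i + 1) := by
  have hpos : (0 : ℝ) < Fintype.card α := by exact_mod_cast Fin.pos (δ (s 0))
  rw [deltaInf_eq_ofDigits, deltaInf_eq_ofDigits, Real.ofDigits_eq_sum_add_ofDigits _ 1]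
  simp only [Finset.sum_range_one, Real.ofDigitsTerm, zero_add, pow_one]
  field_simp

/-- Every cylinder contains the full preimage under `deltaInf` of some point of `(0, 1)`. -/
theorem exists_deltaInf_fiber_subset_cylinder {α : Type*} [Fintype α]
    (δ : α ≃ Fin (Fintype.card α)) (n : ℕ) (s : ℕ → α) :
    ∃ x ∈ Set.Ioo (0 : ℝ) 1, ∀ u : ℕ → α, deltaInf δ u = x → ∀ i < n, u i = s i := by
  induction n generalizing s with
  | zero => exact ⟨1 / 2, by norm_num, fun _ _ i hi => absurd hi i.not_lt_zero⟩
  | succ n ih =>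
    obtain ⟨x, ⟨hx0, hx1⟩, hx⟩ := ih fun i => s (i + 1)
    have hpos : (0 : ℝ) < Fintype.card α := by exact_mod_cast Fin.pos (δ (s 0))
    have hlt : ((δ (s 0) : ℕ) : ℝ) + 1 ≤ Fintype.card α := by exact_mod_cast (δ (s 0)).isLt
    refine ⟨((δ (s 0) : ℕ) + x) / Fintype.card α, ⟨by positivity, ?_⟩, fun u hu i hi => ?_⟩
    · rw [div_lt_one hpos]
      linarith
    · have hmul := card_mul_deltaInf δ u
      rw [hu, mul_div_cancel₀ _ hpos.ne'] at hmul
      obtain ⟨h0, h1⟩ := deltaInf_mem_Icc δ fun i => u (i + 1)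
      have hle : (δ (s 0) : ℕ) < (δ (u 0) : ℕ) + 1 := by
        have : ((δ (s 0) : ℕ) : ℝ) < (δ (u 0) : ℕ) + 1 := by linarith
        exact_mod_cast this
      have hge : (δ (u 0) : ℕ) < (δ (s 0) : ℕ) + 1 := by
        have : ((δ (u 0) : ℕ) : ℝ) < (δ (s 0) : ℕ) + 1 := by linarith
        exact_mod_cast this
      have hδ : (δ (u 0) : ℕ) = (δ (s 0) : ℕ) := by lia
      cases i with
      | zero => exact δ.injective (Fin.ext hδ)
      | succ i => exact hx (fun i => u (i + 1)) (by rw [hδ] at hmul; linarith) i (by lia)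

/-- The set of `q`-accepted configurations is closed: a configuration each of whose prefixes
extends to an accepted configuration is accepted. -/
theorem AcceptsD.of_forall_prefix {d : ℕ} {Q : Type*} {A : Fin d → Type*}
    {T : Set (Q × Q × ((k : Fin d) → List (A k)))} (hT : T.Finite) {q : Q}
    {c : ℕ → (k : Fin d) → A k}
    (h : ∀ n, ∃ c', AcceptsD T q c' ∧ ∀ i < n, c' i = c i) : AcceptsD T q c := by
  have : Finite T := hT
  let : TopologicalSpace T := ⊥
  have : DiscreteTopology T := ⟨rfl⟩
  let K : ℕ → Set (ℕ → T) := fun n =>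
    {t | (t 0).1.1 = q} ∩ (⋂ m, {t | (t m).1.2.1 = (t (m + 1)).1.1}) ∩
      ⋂ k : Fin d, ⋂ m, {t | ∀ j : Fin ((t m).1.2.2 k).length,
        ((Finset.range m).sum fun i => ((t i).1.2.2 k).length) + (j : ℕ) < n →
          c (((Finset.range m).sum fun i => ((t i).1.2.2 k).length) + (j : ℕ)) k =
            ((t m).1.2.2 k).get j}
  have hclosed : ∀ n, IsClosed (K n) := by
    intro n
    refine ((?_ : IsClosed _).inter (isClosed_iInter fun m => ?_)).inter
      (isClosed_iInter fun k => isClosed_iInter fun m => ?_)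
    · exact (isClosed_discrete {e : T | e.1.1 = q}).preimage
        (continuous_apply (A := fun _ : ℕ => T) 0)
    · exact (isClosed_discrete {e : T × T | e.1.1.2.1 = e.2.1.1}).preimage
        ((continuous_apply (A := fun _ : ℕ => T) m).prodMk (continuous_apply (m + 1)))
    · have hcont : Continuous fun t : ℕ → T =>
          ((Finset.range m).sum (fun i => ((t i).1.2.2 k).length), t m) :=
        (continuous_finsetSum _ fun i _ =>
          (continuous_of_discreteTopology (f := fun e : T => (e.1.2.2 k).length)).comp
            (continuous_apply i)).prodMk (continuous_apply m)
      exact (isClosed_discrete {e : ℕ × T | ∀ j : Fin (e.2.1.2.2 k).length,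
        e.1 + (j : ℕ) < n → c (e.1 + (j : ℕ)) k = (e.2.1.2.2 k).get j}).preimage hcont
  have hnonempty : ∀ n, (K n).Nonempty := by
    intro n
    obtain ⟨c', ⟨t, htT, ht0, hchain, hread⟩, hc'⟩ := h n
    refine ⟨fun m => ⟨t m, htT m⟩, ⟨ht0, Set.mem_iInter.2 hchain⟩,
      Set.mem_iInter₂.2 fun k m j hj => ?_⟩
    rw [← hc' _ hj]
    exact hread k m j
  have hanti : ∀ n, K (n + 1) ⊆ K n := fun n =>
    Set.inter_subset_inter_right _ <| Set.iInter₂_mono fun k m t ht j hj =>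
      ht j (hj.trans n.lt_succ_self)
  obtain ⟨t, ht⟩ := IsCompact.nonempty_iInter_of_sequence_nonempty_isCompact_isClosed K hanti
    hnonempty (hclosed 0).isCompact hclosed
  rw [Set.mem_iInter] at ht
  refine ⟨fun m => (t m).1, fun m => (t m).2, (ht 0).1.1, Set.mem_iInter.1 (ht 0).1.2,
    fun k m j => ?_⟩
  exact Set.mem_iInter₂.1 (ht _).2 k m j (Nat.lt_succ_self _)

/-- State `q` is universal if and only if `Y_q` is the whole unit cube `[0,1]^d`. -/
theorem universal_iff_Yset_eq_cube {d : ℕ} {Q : Type*} {A : Fin d → Type*}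
    [∀ k, Fintype (A k)] (hA : ∀ k, 1 < Fintype.card (A k))
    (δ : (k : Fin d) → A k ≃ Fin (Fintype.card (A k)))
    (T : Set (Q × Q × ((k : Fin d) → List (A k)))) (hT : T.Finite)
    (hne : ∀ t ∈ T, ∀ k : Fin d, t.2.2 k ≠ []) (q : Q) :
    (∀ c : ℕ → (k : Fin d) → A k, AcceptsD T q c) ↔
      Yset δ T q = {x | ∀ k, x k ∈ Set.Icc (0 : ℝ) 1} := by
  constructor
  · intro h
    ext x
    constructor
    · rintro ⟨c, -, rfl⟩ k
      exact deltaInf_mem_Icc (δ k) fun i => c i k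
    · intro hx
      choose s hs using fun k => exists_deltaInf_eq (hA k) (δ k) (hx k)
      refine ⟨fun i k => s k i, h _, ?_⟩
      ext k
      exact (hs k).symm
  · intro h c
    refine AcceptsD.of_forall_prefix hT fun n => ?_
    choose x hx hfiber using fun k =>
      exists_deltaInf_fiber_subset_cylinder (δ k) n fun i => c i k
    have hmem : WithLp.toLp 2 x ∈ Yset δ T q := by
      rw [h]
      exact fun k => Set.Ioo_subset_Icc_self (hx k)
    obtain ⟨c', hacc, hc'⟩ := hmem
    refine ⟨c', hacc, fun i hi => funext fun k => ?_⟩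
    exact hfiber k (fun i => c' i k) (congrArg (fun y => y.ofLp k) hc').symm i hi
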